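/- arXiv:1101.6034 — 3 statements merged into one kernel-verified Lean document; each statement's English description precedes it below -/
import Mathlib

section
/- Let H be a complex Hilbert space, S a topological space equipped with a multiplication (s,t) ↦ st and an involution s ↦ s*, and ρ : S → B(H) a map satisfying ρ(st) = ρ(s)ρ(t) and ρ(s*) = ρ(s)* for all s, t ∈ S, which is strongly continuous (for each v ∈ H the map s ↦ ρ(s)v is continuous). Let (I, ≤) be a directed preordered set, (S_i)_{i∈I} a family of subsets of S, each closed under multiplication and under the involution, with S_i ⊆ S_j whenever i ≤ j and with ∪_{i∈I} S_i dense in S, and (H_i)_{i∈I} a family of closed linear subspaces of H with H_i ⊆ H_j whenever i ≤ j and with ∪_{i∈I} H_i dense in H. Assume that for each i ∈ I the subspace H_i is invariant under ρ(s) for every s ∈ S_i, and that the restricted representation ρ_i : S_i → B(H_i), s ↦ ρ(s)|_{H_i}, is irreducible in the sense that every bounded operator on H_i commuting with ρ(s)|_{H_i} for all s ∈ S_i is a complex scalar multiple of the identity. Then ρ is irreducible: every bounded operator a on H with a∘ρ(s) = ρ(s)∘a for all s ∈ S is a complex scalar multiple of the identity operator. -/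
open scoped InnerProductSpace

/-- The compression of `a` to a closed subspace `K` is scalar as soon as `a` commutes with a
self-adjoint family of operators leaving `K` invariant and acting irreducibly on `K`. -/
lemma exists_inner_apply_eq_mul_inner_of_irreducible
    {H : Type*} [NormedAddCommGroup H] [InnerProductSpace ℂ H] [CompleteSpace H]
    (A : Set (H →L[ℂ] H)) (hA : ∀ T ∈ A, ContinuousLinearMap.adjoint T ∈ A)
    (K : Submodule ℂ H) [K.HasOrthogonalProjection]
    (hinv : ∀ T ∈ A, ∀ v ∈ K, T v ∈ K)
    (hirr : ∀ b : K →L[ℂ] K,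
      (∀ T ∈ A, ∀ v w : K, (w : H) = T v → (b w : H) = T (b v)) →
      ∃ z : ℂ, ∀ v : K, b v = z • v)
    (a : H →L[ℂ] H) (ha : ∀ T ∈ A, ∀ v, a (T v) = T (a v)) :
    ∃ z : ℂ, ∀ u ∈ K, ∀ v ∈ K, ⟪u, a v⟫_ℂ = z * ⟪u, v⟫_ℂ := by
  obtain ⟨z, hz⟩ := hirr ((K.orthogonalProjectionOnto.comp a).comp K.subtypeL) (by
    intro T hT v w hw
    simp only [ContinuousLinearMap.comp_apply, Submodule.subtypeL_apply, hw, ha T hT]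
    refine Submodule.eq_starProjection_of_mem_of_inner_eq_zero
      (hinv T hT _ (Submodule.coe_mem _)) fun u hu => ?_
    rw [← map_sub, ← ContinuousLinearMap.adjoint_inner_right]
    exact K.starProjection_inner_eq_zero _ _ (hinv _ (hA T hT) u hu))
  refine ⟨z, fun u hu v hv => ?_⟩
  have h := congrArg (fun x : K => ⟪(⟨u, hu⟩ : K), x⟫_ℂ) (hz ⟨v, hv⟩)
  simpa [inner_smul_right] using h


/-- **Proposition A.5.** Let `ρ : S → B(H)` be a strongly continuous `*`-representation of a
topological involutive semigroup `S` on a complex Hilbert space `H`. Let `(Sᵢ)` be a directed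
family of involutive subsemigroups with dense union, and `(Hᵢ)` a directed family of closed
subspaces with dense union, such that each `Hᵢ` is `ρ(Sᵢ)`-invariant and each restricted
representation `ρᵢ : Sᵢ → B(Hᵢ)` is irreducible. Then `ρ` is irreducible: every bounded
operator commuting with all `ρ(s)` is a scalar multiple of the identity. -/
theorem irreducible_of_directed_union_irreducible
    {H : Type*} [NormedAddCommGroup H] [InnerProductSpace ℂ H] [CompleteSpace H]
    {S : Type*} [TopologicalSpace S] [Mul S] [Star S]
    (rho : S → H →L[ℂ] H)
    (hmul : ∀ s t : S, rho (s * t) = (rho s).comp (rho t))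
    (hstar : ∀ s : S, rho (star s) = ContinuousLinearMap.adjoint (rho s))
    (hcont : ∀ v : H, Continuous fun s => rho s v)
    {I : Type*} [Preorder I] [IsDirected I (· ≤ ·)] [Nonempty I]
    (Ssub : I → Set S)
    (hSmul : ∀ i, ∀ s ∈ Ssub i, ∀ t ∈ Ssub i, s * t ∈ Ssub i)
    (hSstar : ∀ i, ∀ s ∈ Ssub i, star s ∈ Ssub i)
    (hSmono : ∀ i j, i ≤ j → Ssub i ⊆ Ssub j)
    (hSdense : Dense (⋃ i, Ssub i))
    (K : I → Submodule ℂ H)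
    (hKclosed : ∀ i, IsClosed (K i : Set H))
    (hKmono : ∀ i j, i ≤ j → K i ≤ K j)
    (hKdense : Dense (⋃ i, (K i : Set H)))
    (hinv : ∀ i, ∀ s ∈ Ssub i, ∀ v ∈ K i, rho s v ∈ K i)
    (hirr : ∀ i, ∀ b : (K i) →L[ℂ] (K i),
      (∀ s, ∀ hs : s ∈ Ssub i, ∀ v : K i,
        b ⟨rho s ↑v, hinv i s hs ↑v v.2⟩ = ⟨rho s ↑(b v), hinv i s hs ↑(b v) (b v).2⟩) →
      ∃ z : ℂ, ∀ v : K i, b v = z • v) :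
    ∀ a : H →L[ℂ] H, (∀ s : S, a.comp (rho s) = (rho s).comp a) →
      ∃ z : ℂ, ∀ v : H, a v = z • v := by
  intro a ha
  have hcomp : ∀ i, ∃ z : ℂ, ∀ u ∈ K i, ∀ v ∈ K i, ⟪u, a v⟫_ℂ = z * ⟪u, v⟫_ℂ := by
    intro i
    have : CompleteSpace (K i) := (hKclosed i).completeSpace_coe
    refine exists_inner_apply_eq_mul_inner_of_irreducible (rho '' Ssub i) ?_ (K i) ?_ ?_ a ?_
    · rintro _ ⟨s, hs, rfl⟩
      exact ⟨star s, hSstar i s hs, hstar s⟩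
    · rintro _ ⟨s, hs, rfl⟩
      exact hinv i s hs
    · intro b hb
      exact hirr i b fun s hs v => Subtype.ext (hb _ ⟨s, hs, rfl⟩ v _ rfl)
    · rintro _ ⟨s, -, rfl⟩ v
      exact DFunLike.congr_fun (ha s) v
  have hext : ∀ z : ℂ, (∀ v ∈ ⋃ i, (K i : Set H), a v = z • v) → ∃ z : ℂ, ∀ v, a v = z • v :=
    fun z hz => ⟨z, fun v => congrFun
      (Continuous.ext_on hKdense a.continuous (continuous_const_smul z) hz) v⟩
  by_cases hw : ∃ w ∈ ⋃ i, (K i : Set H), w ≠ 0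
  · obtain ⟨w, hw, hw0⟩ := hw
    obtain ⟨k, hk⟩ := Set.mem_iUnion.1 hw
    refine hext (⟪w, a w⟫_ℂ / ⟪w, w⟫_ℂ) fun v hv => ?_
    obtain ⟨j, hj⟩ := Set.mem_iUnion.1 hv
    refine hKdense.eq_of_inner_right (𝕜 := ℂ) fun u hu => ?_
    obtain ⟨i, hi⟩ := Set.mem_iUnion.1 hu
    obtain ⟨l, hkl, hjl⟩ := exists_ge_ge k j
    obtain ⟨m, hlm, him⟩ := exists_ge_ge l i
    obtain ⟨z, hz⟩ := hcomp m
    have hwm := hKmono k m (hkl.trans hlm) hk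
    rw [hz u (hKmono i m him hi) v (hKmono j m (hjl.trans hlm) hj), hz w hwm w hwm,
      mul_div_cancel_right₀ _ (inner_self_ne_zero.2 hw0), inner_smul_right]
  · push Not at hw
    exact hext 0 fun v hv => by simp [hw v hv]
end

section
/- Let V be an infinite-dimensional complex vector space and k ≥ 1 an integer. Let the symmetric group S_k act on the k-th tensor power V^{⊗k} (the tensor product over ℂ of k copies of V) by permuting the tensor factors: σ·(v₁ ⊗ ⋯ ⊗ v_k) = v_{σ⁻¹(1)} ⊗ ⋯ ⊗ v_{σ⁻¹(k)}. Let M be a simple module over the group algebra ℂ[S_k], and let 𝕊(V) := Hom_{S_k}(M, V^{⊗k}) be the complex vector space of ℂ-linear S_k-equivariant maps M → V^{⊗k}, on which the group GL(V) of linear automorphisms of V acts by g·a := g^{⊗k} ∘ a, where g^{⊗k} is the automorphism of V^{⊗k} acting as g on each tensor factor. Then 𝕊(V) is an irreducible GL(V)-module: 𝕊(V) ≠ {0} and its only GL(V)-invariant linear subspaces are {0} and 𝕊(V). -/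
noncomputable section

/-- The `k`-th tensor power `V^{⊗k}` of a complex vector space `V`. -/
abbrev TensorPow (V : Type*) [AddCommGroup V] [Module ℂ V] (k : ℕ) :=
  PiTensorProduct ℂ (fun _ : Fin k => V)

open Module

/-- Polarization of a multilinear map. -/
theorem MultilinearMap.sum_neg_one_pow_smul_sum_compl {R ι E F : Type*} [Fintype ι] [DecidableEq ι]
    [CommRing R] [AddCommGroup E] [Module R E] [AddCommGroup F] [Module R F]
    (f : MultilinearMap R (fun _ : ι => E) F) (h : ι → E) :
    ∑ T : Finset ι, (-1 : ℤ) ^ T.card • f (fun _ => ∑ j ∈ Tᶜ, h j) =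
      ∑ σ : Equiv.Perm ι, f (fun i => h (σ i)) := by
  have expand : ∀ T : Finset ι, (-1 : ℤ) ^ T.card • f (fun _ => ∑ j ∈ Tᶜ, h j) =
      ∑ r : ι → ι, if T ∈ (Finset.univ.image r)ᶜ.powerset then
        (-1 : ℤ) ^ T.card • f (fun i => h (r i)) else 0 := by
    intro T
    rw [f.map_sum_finset (fun _ => h) (fun _ => Tᶜ), Finset.smul_sum, ← Finset.sum_filter]
    refine Finset.sum_congr ?_ fun _ _ => rfl
    ext r
    simp only [Fintype.mem_piFinset, Finset.mem_compl, Finset.mem_filter, Finset.mem_univ,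
      true_and, Finset.mem_powerset, Finset.subset_iff, Finset.mem_image, not_exists]
    exact ⟨fun H x hx i hi => H i (hi ▸ hx), fun H i hi => H hi i rfl⟩
  simp_rw [expand]
  rw [Finset.sum_comm]
  have collapse : ∀ r : ι → ι, (∑ T : Finset ι, if T ∈ (Finset.univ.image r)ᶜ.powerset then
        (-1 : ℤ) ^ T.card • f (fun i => h (r i)) else 0) =
      if Function.Surjective r then f (fun i => h (r i)) else 0 := by
    intro r
    rw [← Finset.sum_filter, Finset.filter_mem_eq_inter, Finset.univ_inter, ← Finset.sum_smul,
      Finset.sum_powerset_neg_one_pow_card, ite_smul, one_smul, zero_smul]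
    refine if_congr ?_ rfl rfl
    simp [Finset.eq_univ_iff_forall, Function.Surjective]
  simp_rw [collapse]
  rw [← Finset.sum_filter]
  symm
  refine Finset.sum_bij (fun σ _ => σ) (by simp [Equiv.surjective])
    (fun _ _ _ _ H => DFunLike.coe_injective H) (fun r hr => ?_) fun _ _ => rfl
  have hr' : Function.Surjective r := by simpa using hr
  exact ⟨Equiv.ofBijective r (Finite.surjective_iff_bijective.mp hr'), by simp, rfl⟩

/-- If a multilinear map takes values in `W` at infinitely many points `(x + c • y, …, x + c • y)`,
then it takes a value in `W` at `(x, …, x)`. -/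
theorem MultilinearMap.mem_of_infinite_add_smul {K ι E F : Type*} [Fintype ι]
    [Field K] [AddCommGroup E] [Module K E] [AddCommGroup F] [Module K F]
    (f : MultilinearMap K (fun _ : ι => E) F) (W : Submodule K F) (x y : E)
    (hf : {c : K | f (fun _ => x + c • y) ∈ W}.Infinite) : f (fun _ => x) ∈ W := by
  classical
  by_contra hx
  obtain ⟨φ, hφx, hφW⟩ := W.exists_le_ker_of_notMem hx
  let p : Polynomial K := ∑ s : Finset ι,
    Polynomial.C (φ (f (s.piecewise (fun _ => x) (fun _ => y)))) * Polynomial.X ^ sᶜ.card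
  have hp : ∀ c, p.eval c = φ (f (fun _ => x + c • y)) := by
    intro c
    have := f.map_add_univ (fun _ => x) (fun _ => c • y)
    rw [show (fun _ : ι => x + c • y) = (fun _ => x) + (fun _ => c • y) from rfl, this, _root_.map_sum,
      Polynomial.eval_finsetSum]
    refine Finset.sum_congr rfl fun s _ => ?_
    have key := f.map_piecewise_smul (fun _ => c) (s.piecewise (fun _ => x) (fun _ => y)) sᶜ
    have e : (sᶜ.piecewise (fun i => c • s.piecewise (fun _ => x) (fun _ => y) i)
        (s.piecewise (fun _ => x) (fun _ => y)) : ι → E) =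
        s.piecewise (fun _ => x) (fun _ => c • y) := by
      funext i
      by_cases hi : i ∈ s <;> simp [hi]
    rw [e] at key
    rw [key, map_smul]
    simp only [Polynomial.eval_mul, Polynomial.eval_C, Polynomial.eval_pow, Polynomial.eval_X,
      Finset.prod_const, smul_eq_mul]
    exact mul_comm _ _
  have hp0 : p = 0 := by
    refine Polynomial.eq_zero_of_infinite_isRoot p (hf.mono fun c hc => ?_)
    simpa [Polynomial.IsRoot, hp] using hφW hc
  apply hφx
  simpa [hp0] using (hp 0).symm

/-- A finite rank endomorphism becomes invertible after adding almost any scalar. -/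
theorem Module.End.infinite_isUnit_add_smul_one {K V : Type*} [Field K] [Infinite K]
    [AddCommGroup V] [Module K V] (h : End K V) [FiniteDimensional K (LinearMap.range h)] :
    {c : K | IsUnit (h + c • (1 : End K V))}.Infinite := by
  let u : End K (LinearMap.range h) := h.rangeRestrict ∘ₗ (LinearMap.range h).subtype
  have hfin : (insert 0 ((fun c => -c) '' spectrum K u)).Finite :=
    ((Module.End.finite_spectrum u).image _).insert 0
  refine hfin.infinite_compl.mono fun c hc => ?_
  simp only [Set.mem_compl_iff, Set.mem_insert_iff, Set.mem_image, not_or, not_exists,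
    not_and] at hc
  obtain ⟨hc0, hcs⟩ := hc
  have hu : IsUnit (algebraMap K (End K (LinearMap.range h)) (-c) - u) := by
    by_contra H
    exact hcs (-c) H (neg_neg c)
  have hbij := (Module.End.isUnit_iff _).mp hu
  have hval : ∀ w : LinearMap.range h,
      (((algebraMap K (End K (LinearMap.range h)) (-c) - u) w : LinearMap.range h) : V) =
        -(c • (w : V) + h w) := by
    intro w
    simp [u, Module.algebraMap_end_apply]
    abel
  rw [Set.mem_ofPred_eq, Module.End.isUnit_iff]
  constructor
  · rw [injective_iff_map_eq_zero]
    intro v hv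
    have hv' : h v + c • v = 0 := by simpa using hv
    have hmem : v ∈ LinearMap.range h := by
      refine ⟨-(c⁻¹ • v), ?_⟩
      rw [map_neg, map_smul, eq_neg_of_add_eq_zero_left hv', smul_neg, neg_neg,
        inv_smul_smul₀ hc0]
    have := hbij.1 (a₁ := ⟨v, hmem⟩) (a₂ := 0) (by
      apply Subtype.ext
      rw [hval, map_zero, add_comm, hv']
      simp)
    exact congrArg Subtype.val this
  · intro v
    obtain ⟨w, hw⟩ := hbij.2 (-(h.rangeRestrict v))
    have hw' : c • (w : V) + h w = h v := by
      have := congrArg Subtype.val hw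
      rw [hval] at this
      exact neg_injective this
    refine ⟨c⁻¹ • (v - w), ?_⟩
    simp only [LinearMap.add_apply, LinearMap.smul_apply, Module.End.one_apply, map_smul, map_sub]
    rw [← hw', inv_smul_eq_iff₀ hc0]
    abel

/-- On a finite-dimensional subspace, every endomorphism of a tensor power agrees with a
combination of tensor products of rank one endomorphisms. -/
theorem PiTensorProduct.exists_mem_span_map_smulRight {K V ι : Type*} [Fintype ι] [Field K]
    [AddCommGroup V] [Module K V] (F : Submodule K (PiTensorProduct K (fun _ : ι => V)))
    [FiniteDimensional K F] (L₀ : End K (PiTensorProduct K (fun _ : ι => V))) :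
    ∃ L ∈ Submodule.span K (Set.range fun q : (ι → Dual K V) × (ι → V) =>
      PiTensorProduct.map (fun j => (q.1 j).smulRight (q.2 j))), ∀ t ∈ F, L t = L₀ t := by
  classical
  let e := Basis.ofVectorSpace K V
  let B := Basis.piTensorProduct (fun _ : ι => e)
  obtain ⟨s, hs⟩ := (Submodule.fg_iff_finiteDimensional F).mpr inferInstance
  let S : Finset (ι → _) := s.biUnion fun t => (B.repr t).support
  refine ⟨∑ I ∈ S, (B.coord I).smulRight (L₀ (B I)), Submodule.sum_mem _ fun I _ => ?_, ?_⟩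
  · have hx : L₀ (B I) ∈ Submodule.span K (Set.range (PiTensorProduct.tprod K)) := by
      rw [PiTensorProduct.span_tprod_eq_top]
      trivial
    generalize L₀ (B I) = x at hx ⊢
    induction hx using Submodule.span_induction with
    | mem x hx =>
      obtain ⟨v, rfl⟩ := hx
      refine Submodule.subset_span ⟨(fun j => e.coord (I j), v), ?_⟩
      refine PiTensorProduct.ext (MultilinearMap.ext fun w => ?_)
      simp [B, PiTensorProduct.map_tprod, MultilinearMap.map_smul_univ]
    | zero =>
      convert Submodule.zero_mem _
      ext
      simp
    | add x y _ _ hx hy =>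
      convert Submodule.add_mem _ hx hy
      ext
      simp
    | smul c x _ hx =>
      convert Submodule.smul_mem _ c hx
      exact LinearMap.ext fun _ => smul_comm _ _ _
  · rw [← hs]
    refine LinearMap.eqOn_span fun t ht => ?_
    have hsub : (B.repr t).support ⊆ S :=
      Finset.subset_biUnion_of_mem (fun t => (B.repr t).support) ht
    conv_rhs => rw [← B.linearCombination_repr t, Finsupp.linearCombination_apply,
      Finsupp.sum_of_support_subset _ hsub _ (by simp), map_sum]
    simp [LinearMap.sum_apply]

/-- A subspace stable under composition with tensor powers of automorphisms is stable under
composition with tensor powers of finite rank endomorphisms. -/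
theorem PiTensorProduct.map_comp_mem_of_finiteDimensional_range {K V M ι : Type*} [Fintype ι]
    [Field K] [Infinite K] [AddCommGroup V] [Module K V] [AddCommGroup M] [Module K M]
    (W : Submodule K (M →ₗ[K] PiTensorProduct K (fun _ : ι => V)))
    (hW : ∀ g : V ≃ₗ[K] V, ∀ a ∈ W,
      (PiTensorProduct.map (fun _ : ι => (g : V →ₗ[K] V))).comp a ∈ W)
    {a : M →ₗ[K] PiTensorProduct K (fun _ : ι => V)} (ha : a ∈ W)
    (h : End K V) [FiniteDimensional K (LinearMap.range h)] :
    (PiTensorProduct.map (fun _ : ι => h)).comp a ∈ W := by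
  let f : MultilinearMap K (fun _ : ι => V →ₗ[K] V) (M →ₗ[K] PiTensorProduct K (fun _ : ι => V)) :=
    (LinearMap.lcomp K _ a).compMultilinearMap (PiTensorProduct.mapMultilinear K _ _)
  refine f.mem_of_infinite_add_smul W h (1 : End K V)
    ((Module.End.infinite_isUnit_add_smul_one h).mono fun c hc => ?_)
  exact hW (LinearEquiv.ofBijective _ ((Module.End.isUnit_iff _).mp hc)) a ha

/-- A subspace stable under composition with tensor powers of automorphisms is stable under
composition with symmetrized tensor products of rank one endomorphisms. -/
theorem PiTensorProduct.sum_perm_map_smulRight_comp_mem {K V M ι : Type*} [Fintype ι]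
    [DecidableEq ι] [Field K] [Infinite K] [AddCommGroup V] [Module K V] [AddCommGroup M]
    [Module K M] (W : Submodule K (M →ₗ[K] PiTensorProduct K (fun _ : ι => V)))
    (hW : ∀ g : V ≃ₗ[K] V, ∀ a ∈ W,
      (PiTensorProduct.map (fun _ : ι => (g : V →ₗ[K] V))).comp a ∈ W)
    {a : M →ₗ[K] PiTensorProduct K (fun _ : ι => V)} (ha : a ∈ W)
    (φ : ι → Dual K V) (v : ι → V) :
    ∑ σ : Equiv.Perm ι,
      (PiTensorProduct.map (fun i => (φ (σ i)).smulRight (v (σ i)))).comp a ∈ W := by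
  let f : MultilinearMap K (fun _ : ι => V →ₗ[K] V) (M →ₗ[K] PiTensorProduct K (fun _ : ι => V)) :=
    (LinearMap.lcomp K _ a).compMultilinearMap (PiTensorProduct.mapMultilinear K _ _)
  have := f.sum_neg_one_pow_smul_sum_compl (fun j => (φ j).smulRight (v j))
  change ∑ σ : Equiv.Perm ι, f (fun i => (φ (σ i)).smulRight (v (σ i))) ∈ W
  rw [← this]
  refine Submodule.sum_mem _ fun T _ => zsmul_mem ?_ _
  have : FiniteDimensional K (LinearMap.range (∑ j ∈ Tᶜ, (φ j).smulRight (v j))) := by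
    have := FiniteDimensional.span_of_finite K (Set.finite_range v)
    refine Submodule.finiteDimensional_of_le (S₂ := Submodule.span K (Set.range v)) ?_
    rintro _ ⟨x, rfl⟩
    rw [LinearMap.sum_apply]
    exact Submodule.sum_mem _ fun j _ =>
      Submodule.smul_mem _ _ (Submodule.subset_span ⟨j, rfl⟩)
  exact PiTensorProduct.map_comp_mem_of_finiteDimensional_range W hW ha _

/-- An irreducible representation of a finite group is finite-dimensional. -/
theorem Module.finite_of_forall_invariant_eq_bot_or_eq_top {K G M : Type*} [Field K] [Group G]
    [Finite G] [AddCommGroup M] [Module K M] (ρ : G →* (M ≃ₗ[K] M)) (hne : ∃ m : M, m ≠ 0)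
    (hsimple : ∀ p : Submodule K M, (∀ g, ∀ m ∈ p, ρ g m ∈ p) → p = ⊥ ∨ p = ⊤) :
    Module.Finite K M := by
  obtain ⟨m, hm⟩ := hne
  let p := Submodule.span K (Set.range fun g => ρ g m)
  have hmp : m ∈ p := Submodule.subset_span ⟨1, by simp⟩
  have hp : ∀ g, ∀ x ∈ p, ρ g x ∈ p := by
    intro g x hx
    induction hx using Submodule.span_induction with
    | mem x hx =>
      obtain ⟨g', rfl⟩ := hx
      exact Submodule.subset_span ⟨g * g', by simp⟩
    | zero => simp
    | add x y _ _ hx hy => simpa using add_mem hx hy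
    | smul c x _ hx => simpa using Submodule.smul_mem _ c hx
  rcases hsimple p hp with h | h
  · exact absurd ((Submodule.mem_bot K).mp (h ▸ hmp)) hm
  · exact ⟨Submodule.fg_def.mpr ⟨_, Set.finite_range _, h⟩⟩

/-- **Theorem A.2.** Let `V` be an infinite-dimensional complex vector space and `k ≥ 1`.
Let `S_k` act on `V^{⊗k}` by permuting the tensor factors, and let `M` be a simple
`ℂ[S_k]`-module.  Then `𝕊(V) = Hom_{S_k}(M, V^{⊗k})`, with `GL(V)` acting by
`g·a = g^{⊗k} ∘ a`, is an irreducible `GL(V)`-module. -/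
theorem schur_functor_irreducible
    {V : Type*} [AddCommGroup V] [Module ℂ V] (hV : ¬ FiniteDimensional ℂ V)
    {k : ℕ} (hk : 1 ≤ k)
    -- the action of `S_k` on `V^{⊗k}` permuting the tensor factors
    (act : Equiv.Perm (Fin k) → (TensorPow V k ≃ₗ[ℂ] TensorPow V k))
    (hact : ∀ (σ : Equiv.Perm (Fin k)) (v : Fin k → V),
      act σ (PiTensorProduct.tprod ℂ v) = PiTensorProduct.tprod ℂ (fun i => v (σ⁻¹ i)))
    -- `M` is a simple module over the group algebra `ℂ[S_k]`
    {M : Type*} [AddCommGroup M] [Module ℂ M]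
    (pi : Equiv.Perm (Fin k) →* (M ≃ₗ[ℂ] M))
    (hMne : ∃ m : M, m ≠ 0)
    (hMsimple : ∀ p : Submodule ℂ M, (∀ σ, ∀ m ∈ p, pi σ m ∈ p) → p = ⊥ ∨ p = ⊤)
    -- `Sv = 𝕊(V)` is the space of `S_k`-equivariant linear maps `M → V^{⊗k}`
    (Sv : Submodule ℂ (M →ₗ[ℂ] TensorPow V k))
    (hSv : ∀ a : M →ₗ[ℂ] TensorPow V k,
      a ∈ Sv ↔ ∀ (σ : Equiv.Perm (Fin k)) (m : M), a (pi σ m) = act σ (a m)) :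
    Sv ≠ ⊥ ∧
    ∀ W : Submodule ℂ (M →ₗ[ℂ] TensorPow V k), W ≤ Sv →
      (∀ g : V ≃ₗ[ℂ] V, ∀ a ∈ W,
        (PiTensorProduct.map (fun _ : Fin k => (g : V →ₗ[ℂ] V))).comp a ∈ W) →
      W = ⊥ ∨ W = Sv := by
  classical
  have act_mul : ∀ σ τ x, act (σ * τ) x = act σ (act τ x) := by
    intro σ τ x
    have : (act (σ * τ) : TensorPow V k →ₗ[ℂ] TensorPow V k) =
        (act σ : TensorPow V k →ₗ[ℂ] TensorPow V k) ∘ₗ act τ := by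
      refine PiTensorProduct.ext (MultilinearMap.ext fun v => ?_)
      simp [hact]
    exact LinearMap.congr_fun this x
  have act_one : ∀ x, act 1 x = x := by
    intro x
    have h := act_mul 1 1 x
    rw [mul_one] at h
    exact ((act 1).injective h).symm
  have hfin : Module.Finite ℂ M :=
    Module.finite_of_forall_invariant_eq_bot_or_eq_top pi hMne hMsimple
  constructor
  · obtain ⟨m, hm⟩ := hMne
    obtain ⟨ξ, hξ⟩ := Module.Projective.exists_dual_ne_zero ℂ hm
    let e := Basis.ofVectorSpace ℂ V
    have : Infinite (Basis.ofVectorSpaceIndex ℂ V) := by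
      by_contra H
      rw [not_infinite_iff_finite] at H
      exact hV (Module.Finite.of_basis e)
    let ι := Infinite.natEmbedding (Basis.ofVectorSpaceIndex ℂ V)
    let I : Fin k → Basis.ofVectorSpaceIndex ℂ V := fun j => ι j
    have hI : Function.Injective I := fun i j h => Fin.ext (ι.injective h)
    let B := Basis.piTensorProduct (fun _ : Fin k => e)
    let a : M →ₗ[ℂ] TensorPow V k := ∑ σ : Equiv.Perm (Fin k),
      (ξ ∘ₗ (pi σ⁻¹ : M →ₗ[ℂ] M)).smulRight (act σ (B I))
    have ha : a ∈ Sv := by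
      rw [hSv]
      intro τ x
      have h_inv : ∀ y, act τ (act τ⁻¹ y) = y := fun y => by
        rw [← act_mul, mul_inv_cancel, act_one]
      simp only [a, LinearMap.sum_apply, map_sum]
      refine Fintype.sum_equiv (Equiv.mulLeft τ⁻¹) _ _ fun σ => ?_
      simp [act_mul, map_mul, h_inv]
    intro hbot
    rw [hbot, Submodule.mem_bot] at ha
    apply hξ
    have h0 : B.repr (a m) I = 0 := by simp [ha]
    have hcoord : ∀ σ : Equiv.Perm (Fin k), B.repr (act σ (B I)) I = if σ = 1 then 1 else 0 := by
      intro σ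
      have : act σ (B I) = B (fun i => I (σ⁻¹ i)) := by simp [B, hact]
      rw [this, B.repr_self, Finsupp.single_apply]
      refine if_congr ?_ rfl rfl
      constructor
      · intro h
        rw [← inv_eq_one]
        exact Equiv.ext fun i => hI (congrFun h i)
      · rintro rfl
        simp
    have h1 : ∀ x, (1 : M ≃ₗ[ℂ] M).symm x = x := fun _ => rfl
    simpa [a, LinearMap.sum_apply, hcoord, h1] using h0
  · intro W hWS hW
    by_cases hWbot : W = ⊥
    · exact Or.inl hWbot
    right
    refine le_antisymm hWS fun b hb => ?_
    obtain ⟨a, ha, ha0⟩ := W.ne_bot_iff.mp hWbot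
    have hae := (hSv a).mp (hWS ha)
    have hbe := (hSv b).mp hb
    have hker : LinearMap.ker a = ⊥ := by
      refine (hMsimple (LinearMap.ker a) fun σ m hm => ?_).resolve_right fun h =>
        ha0 (LinearMap.ker_eq_top.mp h)
      rw [LinearMap.mem_ker] at hm ⊢
      rw [hae, hm, map_zero]
    obtain ⟨r, hr⟩ := a.exists_leftInverse_of_injective hker
    obtain ⟨L, hL, hLa⟩ := PiTensorProduct.exists_mem_span_map_smulRight (LinearMap.range a)
      (b ∘ₗ r)
    let Ψ : (TensorPow V k →ₗ[ℂ] TensorPow V k) →ₗ[ℂ] (M →ₗ[ℂ] TensorPow V k) :=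
      ∑ σ : Equiv.Perm (Fin k),
        (LinearMap.lcomp ℂ _ ((act σ : TensorPow V k →ₗ[ℂ] TensorPow V k) ∘ₗ a)) ∘ₗ
          (LinearMap.llcomp ℂ _ _ _ (act σ⁻¹ : TensorPow V k →ₗ[ℂ] TensorPow V k))
    have hΨ : ∀ N m, Ψ N m = ∑ σ, act σ⁻¹ (N (act σ (a m))) := by
      intro N m
      simp [Ψ, LinearMap.sum_apply]
    have hmap : ∀ (g : Fin k → V →ₗ[ℂ] V) (σ : Equiv.Perm (Fin k)) (x : TensorPow V k),
        act σ⁻¹ (PiTensorProduct.map g (act σ x)) = PiTensorProduct.map (fun i => g (σ i)) x := by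
      intro g σ x
      have : (act σ⁻¹ : TensorPow V k →ₗ[ℂ] TensorPow V k) ∘ₗ PiTensorProduct.map g ∘ₗ
          (act σ : TensorPow V k →ₗ[ℂ] TensorPow V k) =
          PiTensorProduct.map (fun i => g (σ i)) := by
        refine PiTensorProduct.ext (MultilinearMap.ext fun v => ?_)
        simp [hact, PiTensorProduct.map_tprod]
      exact LinearMap.congr_fun this x
    have hΨW : Ψ L ∈ W := by
      suffices h : Submodule.span ℂ _ ≤ W.comap Ψ from h hL
      rw [Submodule.span_le]
      rintro _ ⟨q, rfl⟩
      have := PiTensorProduct.sum_perm_map_smulRight_comp_mem W hW ha q.1 q.2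
      rw [SetLike.mem_coe, Submodule.mem_comap]
      convert this
      ext m
      simp [hΨ, hmap, LinearMap.sum_apply]
    have hΨb : Ψ L = (Nat.factorial k : ℂ) • b := by
      ext m
      rw [hΨ]
      have : ∀ σ, act σ⁻¹ (L (act σ (a m))) = b m := by
        intro σ
        rw [← hae, hLa _ (LinearMap.mem_range_self _ _), LinearMap.comp_apply,
          show r (a (pi σ m)) = pi σ m from LinearMap.congr_fun hr _, hbe, ← act_mul,
          inv_mul_cancel, act_one]
      rw [Finset.sum_congr rfl fun σ _ => this σ, LinearMap.smul_apply, Nat.cast_smul_eq_nsmul]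
      simp [Fintype.card_perm]
    rw [hΨb] at hΨW
    exact (Submodule.smul_mem_iff _ (Nat.cast_ne_zero.mpr k.factorial_ne_zero)).mp hΨW
end
end

section
/- Let A be a unital C*-algebra, H a complex Hilbert space, and π : A → B(H) a unital *-homomorphism that is (topologically) irreducible, i.e. the only closed linear subspaces of H invariant under π(a) for all a ∈ A are {0} and H. Then the image π(U(A)) of the unitary group U(A) = {g ∈ A : g*g = gg* = 1} is dense in the unitary group U(H) of H with respect to the strong operator topology: for every unitary operator u on H, every ε > 0, and every finite family of vectors v₁, …, vₙ ∈ H, there exists g ∈ U(A) with ‖π(g)vᵢ − u vᵢ‖ < ε for i = 1, …, n. -/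
/-- A self-adjoint operator commuting with an irreducible set of operators is scalar. -/
theorem exists_eq_smul_one_of_isSelfAdjoint_of_commute
    {H : Type*} [NormedAddCommGroup H] [InnerProductSpace ℂ H] [CompleteSpace H]
    {S : Set (H →L[ℂ] H)}
    (hirr : ∀ K : Submodule ℂ H, IsClosed (K : Set H) →
      (∀ a ∈ S, ∀ v ∈ K, a v ∈ K) → K = ⊥ ∨ K = ⊤)
    {T : H →L[ℂ] H} (hT : IsSelfAdjoint T) (hcomm : ∀ a ∈ S, Commute T a) :
    ∃ c : ℂ, T = c • 1 := by
  rcases subsingleton_or_nontrivial H with hH | hH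
  · exact ⟨0, Subsingleton.elim _ _⟩
  have key : ∀ f g : ℝ → ℝ, Continuous f → Continuous g → (∀ x, f x * g x = 0) →
      cfc f T = 0 ∨ cfc g T = 0 := by
    intro f g hf hg hfg
    have hmul : cfc f T * cfc g T = 0 := by
      rw [← cfc_mul f g T hf.continuousOn hg.continuousOn]
      simp [hfg]
    rcases hirr (cfc f T).ker (cfc f T).isClosed_ker (fun a ha v hv => by
      have h := DFunLike.congr_fun ((hcomm a ha).cfc_real f).eq v
      simp only [mul_apply_eq_comp] at h
      rw [LinearMap.mem_ker] at hv ⊢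
      exact h.trans ((congrArg a hv).trans (map_zero a))) with h | h
    · right
      ext v
      have : cfc g T v ∈ (cfc f T).ker := by
        rw [LinearMap.mem_ker]
        exact DFunLike.congr_fun hmul v
      rw [h] at this
      simpa using this
    · left
      ext v
      have : v ∈ (cfc f T).ker := h ▸ Submodule.mem_top
      simpa using this
  have pos : ∀ f : ℝ → ℝ, Continuous f → cfc f T = 0 → ∀ x ∈ spectrum ℝ T, f x = 0 := by
    intro f hf h x hx
    have : f x ∈ spectrum ℝ (cfc f T) := by
      rw [cfc_map_spectrum f T hT hf.continuousOn]
      exact ⟨x, hx, rfl⟩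
    rw [h, spectrum.zero_eq] at this
    exact this
  have hsub : (spectrum ℝ T).Subsingleton := by
    intro x hx y hy
    by_contra hne
    wlog hlt : x < y generalizing x y
    · exact this hy hx (Ne.symm hne) (lt_of_le_of_ne (not_lt.1 hlt) (Ne.symm hne))
    rcases key (fun t => max (t - (x + y) / 2) 0) (fun t => max ((x + y) / 2 - t) 0)
      (by fun_prop) (by fun_prop) (fun t => by
        rcases le_total t ((x + y) / 2) with h | h
        · rw [max_eq_right (by linarith), zero_mul]
        · rw [max_eq_right (b := (0 : ℝ)) (a := (x + y) / 2 - t) (by linarith), mul_zero])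
      with h | h
    · have := pos _ (by fun_prop) h y hy
      have := max_eq_right_iff.1 this
      linarith
    · have := pos _ (by fun_prop) h x hx
      have := max_eq_right_iff.1 this
      linarith
  obtain ⟨c, hc⟩ := ContinuousFunctionalCalculus.spectrum_nonempty (R := ℝ) T hT
  refine ⟨c, ?_⟩
  have : cfc (fun x : ℝ => x) T = cfc (fun _ : ℝ => c) T :=
    cfc_congr fun x hx => hsub hx hc
  rw [cfc_id' ℝ T, cfc_const c T, Algebra.algebraMap_eq_smul_one] at this
  rw [this]
  ext v
  simp

/-- **Schur's lemma**: the commutant of an irreducible star-closed set of operators is scalar. -/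
theorem exists_eq_smul_one_of_commute
    {H : Type*} [NormedAddCommGroup H] [InnerProductSpace ℂ H] [CompleteSpace H]
    {S : Set (H →L[ℂ] H)} (hS : ∀ a ∈ S, star a ∈ S)
    (hirr : ∀ K : Submodule ℂ H, IsClosed (K : Set H) →
      (∀ a ∈ S, ∀ v ∈ K, a v ∈ K) → K = ⊥ ∨ K = ⊤)
    {T : H →L[ℂ] H} (hcomm : ∀ a ∈ S, Commute T a) :
    ∃ c : ℂ, T = c • 1 := by
  have hstar : ∀ a ∈ S, Commute (star T) a := fun a ha => by
    simpa using (hcomm _ (hS a ha)).star_star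
  obtain ⟨c, hc⟩ := exists_eq_smul_one_of_isSelfAdjoint_of_commute hirr
    (realPart T).2 fun a ha => by
      rw [realPart_apply_coe]
      exact ((hcomm a ha).add_left (hstar a ha)).smul_left _
  obtain ⟨d, hd⟩ := exists_eq_smul_one_of_isSelfAdjoint_of_commute hirr
    (imaginaryPart T).2 fun a ha => by
      rw [imaginaryPart_apply_coe]
      exact (((hcomm a ha).sub_left (hstar a ha)).smul_left _).smul_left _
  refine ⟨c + Complex.I * d, ?_⟩
  rw [← realPart_add_I_smul_imaginaryPart T, hc, hd, add_smul, mul_smul]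

/-- A finite sum of vector functionals vanishing on an irreducible star subalgebra of `B(H)`
vanishes on `B(H)`. -/
theorem sum_inner_apply_eq_zero_of_forall_mem
    {H : Type*} [NormedAddCommGroup H] [InnerProductSpace ℂ H] [CompleteSpace H]
    (S : StarSubalgebra ℂ (H →L[ℂ] H))
    (hirr : ∀ K : Submodule ℂ H, IsClosed (K : Set H) →
      (∀ a ∈ S, ∀ v ∈ K, a v ∈ K) → K = ⊥ ∨ K = ⊤)
    {ι : Type*} [Fintype ι] (w e : ι → H) (h : ∀ a ∈ S, ∑ j, inner ℂ (w j) (a (e j)) = 0)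
    (T : H →L[ℂ] H) : ∑ j, inner ℂ (w j) (T (e j)) = 0 := by
  classical
  let D : (H →L[ℂ] H) → (PiLp 2 fun _ : ι => H) →ₗ[ℂ] PiLp 2 fun _ : ι => H := fun a =>
    { toFun := fun x => WithLp.toLp 2 fun j => a (x j)
      map_add' := fun x y => by ext; simp
      map_smul' := fun c x => by ext; simp }
  have hD : ∀ a (x : PiLp 2 fun _ : ι => H) j, (D a x) j = a (x j) := fun _ _ _ => rfl
  have hDc : ∀ a, Continuous (D a) := fun a =>
    (PiLp.continuous_toLp 2 _).comp (continuous_pi fun j =>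
      a.continuous.comp ((continuous_apply j).comp (PiLp.continuous_ofLp 2 _)))
  have hDadj : ∀ a (x y : PiLp 2 fun _ : ι => H),
      inner ℂ x (D a y) = inner ℂ (D (star a) x) y := fun a x y => by
    simp only [PiLp.inner_apply, hD, ContinuousLinearMap.star_eq_adjoint,
      ContinuousLinearMap.adjoint_inner_left]
  let E : PiLp 2 fun _ : ι => H := WithLp.toLp 2 e
  let ev : (H →L[ℂ] H) →ₗ[ℂ] PiLp 2 fun _ : ι => H :=
    { toFun := fun a => D a E
      map_add' := fun a b => by ext; simp [hD]
      map_smul' := fun c a => by ext; simp [hD] }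
  let K : Submodule ℂ (PiLp 2 fun _ : ι => H) :=
    (S.toSubalgebra.toSubmodule.map ev).topologicalClosure
  have hKclosed : IsClosed (K : Set (PiLp 2 fun _ : ι => H)) :=
    Submodule.isClosed_topologicalClosure _
  have : CompleteSpace K := hKclosed.completeSpace_coe
  have hEK : E ∈ K := Submodule.le_topologicalClosure _ ⟨1, S.one_mem, by ext; simp [ev, hD]⟩
  have hinv : ∀ a ∈ S, ∀ x ∈ K, D a x ∈ K := by
    intro a ha x hx
    refine map_mem_closure (hDc a) hx ?_
    rintro _ ⟨b, hb, rfl⟩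
    exact ⟨a * b, S.mul_mem ha hb, by ext; simp [ev, hD]⟩
  have hcomm : ∀ a ∈ S, ∀ x, K.starProjection (D a x) = D a (K.starProjection x) := by
    intro a ha x
    refine Submodule.eq_starProjection_of_mem_of_inner_eq_zero
      (hinv a ha _ (K.starProjection_apply_mem x)) fun y hy => ?_
    rw [← map_sub, ← inner_conj_symm, hDadj, inner_conj_symm]
    exact Submodule.starProjection_inner_eq_zero _ _ (hinv _ (star_mem ha) y hy)
  let P : ι → ι → H →L[ℂ] H := fun i j =>
    (PiLp.proj 2 (fun _ : ι => H) i : (PiLp 2 fun _ : ι => H) →L[ℂ] H) ∘L K.starProjection ∘L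
      ((PiLp.continuousLinearEquiv 2 ℂ fun _ : ι => H).symm :
          (ι → H) →L[ℂ] PiLp 2 fun _ : ι => H) ∘L
        ContinuousLinearMap.single ℂ (fun _ : ι => H) j
  have hP : ∀ i j x, P i j x = K.starProjection (WithLp.toLp 2 (Pi.single j x)) i :=
    fun _ _ _ => rfl
  have hPsum : ∀ (x : PiLp 2 fun _ : ι => H) i, K.starProjection x i = ∑ j, P i j (x j) := by
    intro x i
    have hx : x = ∑ j, WithLp.toLp 2 (Pi.single j (x j)) := by
      ext k
      simp [Finset.sum_apply, Pi.single_apply]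
    conv_lhs => rw [hx]
    rw [map_sum]
    simp [hP, -PiLp.toLp_single]
  have hscal : ∀ i j, ∃ c : ℂ, P i j = c • 1 := by
    intro i j
    refine exists_eq_smul_one_of_commute (S := (S : Set (H →L[ℂ] H)))
      (fun a ha => star_mem ha) hirr fun a ha => ?_
    ext x
    rw [mul_apply_eq_comp, mul_apply_eq_comp, hP, hP, ← hD, ← hcomm a ha]
    refine congrArg (fun y : PiLp 2 fun _ : ι => H => K.starProjection y i) (PiLp.ext fun k => ?_)
    rw [hD]
    rcases eq_or_ne k j with rfl | hk
    · simp
    · simp [hk]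
  choose c hc using hscal
  have hTE : D T E ∈ K := by
    rw [← Submodule.starProjection_eq_self_iff]
    ext i
    rw [hPsum]
    have hEi : E i = ∑ j, c i j • E j := by
      conv_lhs => rw [← Submodule.starProjection_eq_self_iff.2 hEK, hPsum]
      simp [hc]
    rw [hD, hEi, map_sum]
    simp [hc, hD]
  have hle : K ≤ (ℂ ∙ (WithLp.toLp 2 w : PiLp 2 fun _ : ι => H))ᗮ := by
    refine Submodule.topologicalClosure_minimal _ ?_ (Submodule.isClosed_orthogonal _)
    rintro _ ⟨a, ha, rfl⟩
    rw [Submodule.mem_orthogonal_singleton_iff_inner_right]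
    simpa [PiLp.inner_apply, ev, hD, E] using h a ha
  have := Submodule.mem_orthogonal_singleton_iff_inner_right.1 (hle hTE)
  simpa [PiLp.inner_apply, hD, E] using this

theorem IsSelfAdjoint.exp_smul_I_smul_mem_unitary {R : Type*} [NormedRing R] [NormedAlgebra ℂ R]
    [StarRing R] [ContinuousStar R] [CompleteSpace R] [StarModule ℂ R] {a : R}
    (ha : IsSelfAdjoint a) (t : ℝ) :
    NormedSpace.exp ((t : ℂ) • Complex.I • a) ∈ unitary R := by
  have hta : IsSelfAdjoint ((t : ℂ) • a) :=
    (show IsSelfAdjoint (t : ℂ) from Complex.conj_ofReal t).smul ha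
  rw [smul_comm]
  exact (selfAdjoint.expUnitary ⟨_, hta⟩).2

/-- If `J` intertwines two self-adjoint operators up to `δ`, it intertwines the unitaries they
generate up to `δ`. -/
theorem norm_apply_exp_sub_exp_apply_le
    {V H : Type*} [NormedAddCommGroup V] [InnerProductSpace ℂ V] [CompleteSpace V]
    [NormedAddCommGroup H] [InnerProductSpace ℂ H] [CompleteSpace H]
    (J : V →L[ℂ] H) {h : V →L[ℂ] V} (hh : IsSelfAdjoint h) {B : H →L[ℂ] H}
    (hB : IsSelfAdjoint B) {δ : ℝ} (hδ : ∀ x, ‖J (h x) - B (J x)‖ ≤ δ * ‖x‖) (x : V) :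
    ‖J (NormedSpace.exp (Complex.I • h) x) - NormedSpace.exp (Complex.I • B) (J x)‖ ≤
      δ * ‖x‖ := by
  let W : ℂ → V →L[ℂ] V := fun t => NormedSpace.exp (t • Complex.I • h)
  let U : ℂ → H →L[ℂ] H := fun t => NormedSpace.exp (t • Complex.I • -B)
  have hW : ∀ t : ℝ, W t ∈ unitary (V →L[ℂ] V) := hh.exp_smul_I_smul_mem_unitary
  have hU : ∀ t : ℝ, U t ∈ unitary (H →L[ℂ] H) := hB.neg.exp_smul_I_smul_mem_unitary
  have hderiv : ∀ t : ℝ, HasDerivAt (fun t : ℝ => U t (J (W t x)))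
      (U t (Complex.I • (J (h (W t x)) - B (J (W t x))))) t := by
    intro t
    have h1 : HasDerivAt U _ (t : ℂ) := hasDerivAt_exp_smul_const (Complex.I • -B) (t : ℂ)
    have h2 : HasDerivAt W _ (t : ℂ) := hasDerivAt_exp_smul_const' (Complex.I • h) (t : ℂ)
    have h3 : HasDerivAt (fun t => J (W t x)) _ (t : ℂ) :=
      J.hasFDerivAt.comp_hasDerivAt _ (h2.clm_apply (hasDerivAt_const (t : ℂ) x))
    convert! (h1.clm_apply h3).scomp t Complex.ofRealCLM.hasDerivAt using 1
    simp [U, W, sub_eq_neg_add]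
  have hbound := norm_image_sub_le_of_norm_deriv_le_segment_01' (f := fun t : ℝ => U t (J (W t x)))
    (fun t _ => (hderiv t).hasDerivWithinAt) (C := δ * ‖x‖) (fun t _ => by
      rw [ContinuousLinearMap.norm_map_of_mem_unitary (hU t), norm_smul, Complex.norm_I, one_mul]
      refine (hδ _).trans_eq ?_
      rw [ContinuousLinearMap.norm_map_of_mem_unitary (hW t)])
  have hinv : U (1 : ℝ) * NormedSpace.exp (Complex.I • B) = 1 := by
    let +nondep : NormedAlgebra ℚ (H →L[ℂ] H) := .restrictScalars ℚ ℂ _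
    simp only [U, Complex.ofReal_one, one_smul]
    rw [← NormedSpace.exp_add_of_commute (by simp), smul_neg, neg_add_cancel, NormedSpace.exp_zero]
  have hinv' : U (1 : ℝ) (NormedSpace.exp (Complex.I • B) (J x)) = J x :=
    DFunLike.congr_fun hinv (J x)
  rw [← ContinuousLinearMap.norm_map_of_mem_unitary (hU 1), map_sub, hinv']
  simpa [U, W] using hbound

/-- A unitary on a finite-dimensional space has a self-adjoint logarithm. -/
theorem exists_isSelfAdjoint_exp_eq
    {V : Type*} [NormedAddCommGroup V] [InnerProductSpace ℂ V] [FiniteDimensional ℂ V]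
    [CompleteSpace V] {W : V →L[ℂ] V}
    (hW : W ∈ unitary (V →L[ℂ] V)) :
    ∃ h : V →L[ℂ] V, IsSelfAdjoint h ∧ NormedSpace.exp (Complex.I • h) = W := by
  have hfin : (spectrum ℂ W).Finite := by
    rw [← AlgEquiv.spectrum_eq (Module.End.toContinuousLinearMap (𝕜 := ℂ) V).symm]
    exact Module.End.finite_spectrum _
  have hcont : ∀ f : ℂ → ℂ, ContinuousOn f (spectrum ℂ W) := fun f =>
    hfin.continuousOn f
  have hnorm : IsStarNormal W := isStarNormal_of_mem_unitary hW
  have hsa : IsSelfAdjoint (cfc (fun z : ℂ => (z.arg : ℂ)) W) := by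
    rw [IsSelfAdjoint, ← cfc_star]
    simp
  refine ⟨_, hsa, ?_⟩
  rw [← CFC.exp_eq_normedSpace_exp (𝕜 := ℂ),
    ← cfc_smul _ _ _ (hcont _), ← cfc_comp' _ _ _ (by fun_prop) (hcont _)]
  conv_rhs => rw [← cfc_id' ℂ W]
  refine cfc_congr fun z hz => ?_
  have hz1 := spectrum.norm_eq_one_of_unitary hW hz
  have := Complex.norm_mul_exp_arg_mul_I z
  simpa [hz1, ← Complex.exp_eq_exp_ℂ, mul_comm] using this

/-- Self-adjoint operators are strongly approximated by images of self-adjoint elements under an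
irreducible representation. -/
theorem exists_isSelfAdjoint_forall_norm_sub_lt
    {A : Type*} [NormedRing A] [StarRing A] [NormedAlgebra ℂ A] [StarModule ℂ A]
    {H : Type*} [NormedAddCommGroup H] [InnerProductSpace ℂ H] [CompleteSpace H]
    (π : A →⋆ₐ[ℂ] (H →L[ℂ] H))
    (hirr : ∀ K : Submodule ℂ H, IsClosed (K : Set H) →
      (∀ a : A, ∀ v ∈ K, π a v ∈ K) → K = ⊥ ∨ K = ⊤)
    {T : H →L[ℂ] H} (hT : IsSelfAdjoint T) {ι : Type*} [Fintype ι] (e : ι → H) {δ : ℝ}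
    (hδ : 0 < δ) : ∃ a : A, IsSelfAdjoint a ∧ ∀ j, ‖T (e j) - π a (e j)‖ < δ := by
  classical
  let R : Submodule ℝ (ι → H) :=
    { carrier := {x | ∃ a : A, IsSelfAdjoint a ∧ (fun j => π a (e j)) = x}
      add_mem' := by
        rintro _ _ ⟨a, ha, rfl⟩ ⟨b, hb, rfl⟩
        exact ⟨a + b, ha.add hb, by ext; simp⟩
      zero_mem' := ⟨0, .zero _, by ext; simp⟩
      smul_mem' := by
        rintro r _ ⟨a, ha, rfl⟩
        exact ⟨(r : ℂ) • a, (show IsSelfAdjoint (r : ℂ) from Complex.conj_ofReal r).smul ha,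
          by ext; rw [map_smul]; rfl⟩ }
  have hmem : (fun j => T (e j)) ∈ closure (R : Set (ι → H)) := by
    by_contra hnot
    obtain ⟨f, u, hf, hu⟩ := RCLike.geometric_hahn_banach_closed_point (𝕜 := ℂ)
      R.convex.closure isClosed_closure hnot
    have hR : ∀ x ∈ R, (f x).re = 0 := by
      intro x hx
      have hlt : ∀ r : ℝ, r * (f x).re < u := fun r => by
        have := hf _ (subset_closure (R.smul_mem r hx))
        rwa [← Complex.coe_smul, map_smul, smul_eq_mul, RCLike.re_eq_complex_re,
          Complex.re_ofReal_mul] at this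
      by_contra h0
      have := hlt (u / (f x).re)
      rw [div_mul_cancel₀ _ h0] at this
      exact lt_irrefl _ this
    have hu0 : 0 < u := by simpa using hf 0 (subset_closure R.zero_mem)
    let w : ι → H := fun j => (InnerProductSpace.toDual ℂ H).symm
      (f ∘L ContinuousLinearMap.single ℂ (fun _ : ι => H) j)
    have hfw : ∀ x : ι → H, f x = ∑ j, inner ℂ (w j) (x j) := fun x => by
      simp only [w, InnerProductSpace.toDual_symm_apply, ContinuousLinearMap.comp_apply,
        ContinuousLinearMap.single_apply, ← map_sum, Finset.univ_sum_single]
    have hsymm : ∀ B : H →L[ℂ] H, IsSelfAdjoint B →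
        ∑ j, inner ℂ (w j) (B (e j)) + ∑ j, inner ℂ (e j) (B (w j)) =
          ((2 * (f fun j => B (e j)).re : ℝ) : ℂ) := by
      intro B hB
      have hadj : ∀ j, inner ℂ (e j) (B (w j)) = (starRingEnd ℂ) (inner ℂ (w j) (B (e j))) :=
        fun j => by
          rw [inner_conj_symm, ← ContinuousLinearMap.adjoint_inner_left,
            ← ContinuousLinearMap.star_eq_adjoint, hB.star_eq]
      simp only [hadj]
      rw [← map_sum, Complex.add_conj, hfw]
    have hsa : ∀ a : A, IsSelfAdjoint a →
        ∑ j, inner ℂ (w j) (π a (e j)) + ∑ j, inner ℂ (e j) (π a (w j)) = 0 := by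
      intro a ha
      rw [hsymm _ (ha.map π), hR _ ⟨a, ha, rfl⟩]
      simp
    have hT0 := sum_inner_apply_eq_zero_of_forall_mem π.range
      (fun K hK h => hirr K hK fun a => h _ ⟨a, rfl⟩) (Sum.elim w e) (Sum.elim e w) (by
        rintro _ ⟨a, rfl⟩
        simp only [Fintype.sum_sum_type, Sum.elim_inl, Sum.elim_inr]
        have h1 := hsa _ (realPart a).2
        have h2 := hsa _ (imaginaryPart a).2
        have h3 : π a = π (realPart a : A) + Complex.I • π (imaginaryPart a : A) := by
          rw [← map_smul, ← map_add, realPart_add_I_smul_imaginaryPart]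
        change ∑ j, inner ℂ (w j) (π a (e j)) + ∑ j, inner ℂ (e j) (π a (w j)) = 0
        simp only [h3, add_apply, smul_apply, inner_add_right, inner_smul_right,
          Finset.sum_add_distrib, ← Finset.mul_sum]
        linear_combination h1 + Complex.I * h2) T
    simp only [Fintype.sum_sum_type, Sum.elim_inl, Sum.elim_inr] at hT0
    rw [hsymm T hT] at hT0
    have : (f fun j => T (e j)).re = 0 := by simpa using hT0
    rw [RCLike.re_eq_complex_re, this] at hu
    exact lt_asymm hu0 hu
  obtain ⟨_, ⟨a, ha, rfl⟩, hdist⟩ := Metric.mem_closure_iff.1 hmem δ hδ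
  refine ⟨a, ha, fun j => ?_⟩
  rw [← dist_eq_norm]
  exact (dist_le_pi_dist _ _ j).trans_lt hdist

/-- A unitary agrees on any finite family of vectors with a unitary of a finite-dimensional
subspace containing the family. -/
theorem exists_finiteDimensional_unitary_eq_apply
    {H : Type*} [NormedAddCommGroup H] [InnerProductSpace ℂ H] [CompleteSpace H]
    {u : H →L[ℂ] H} (hu : u ∈ unitary (H →L[ℂ] H)) {ι : Type*} [Finite ι] (v : ι → H) :
    ∃ (E : Submodule ℂ H) (_ : FiniteDimensional ℂ E) (W : E →L[ℂ] E),
      W ∈ unitary (E →L[ℂ] E) ∧ ∀ i, ∃ h : v i ∈ E, (W ⟨v i, h⟩ : H) = u (v i) := by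
  let F : Submodule ℂ H := Submodule.span ℂ (Set.range v)
  have : FiniteDimensional ℂ F := .span_of_finite ℂ (Set.finite_range v)
  let E : Submodule ℂ H := F ⊔ F.map (u : H →ₗ[ℂ] H)
  have : FiniteDimensional ℂ E := inferInstance
  have hF : ∀ i, v i ∈ F := fun i => Submodule.subset_span ⟨i, rfl⟩
  have hFE : F ≤ E := le_sup_left
  let F' : Submodule ℂ E := F.comap E.subtype
  let L : F' →ₗᵢ[ℂ] E :=
    { toLinearMap := ((u : H →ₗ[ℂ] H) ∘ₗ E.subtype ∘ₗ F'.subtype).codRestrict E fun x =>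
        Submodule.mem_sup_right ⟨x, x.2, rfl⟩
      norm_map' := fun x => ContinuousLinearMap.norm_map_of_mem_unitary hu (x : H) }
  let W : E ≃ₗᵢ[ℂ] E := L.extend.toLinearIsometryEquiv rfl
  refine ⟨E, this, W.toContinuousLinearEquiv, ?_, fun i => ⟨hFE (hF i), ?_⟩⟩
  · exact (Unitary.linearIsometryEquiv.symm W).2
  · exact congrArg Subtype.val (L.extend_apply ⟨⟨v i, hFE (hF i)⟩, hF i⟩)

theorem norm_apply_le_of_orthonormalBasis {V H : Type*} [NormedAddCommGroup V]
    [InnerProductSpace ℂ V] [NormedAddCommGroup H] [NormedSpace ℂ H] {ι : Type*} [Fintype ι]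
    (b : OrthonormalBasis ι ℂ V) (T : V →L[ℂ] H) {δ : ℝ} (hδ : ∀ j, ‖T (b j)‖ ≤ δ) (x : V) :
    ‖T x‖ ≤ Fintype.card ι * δ * ‖x‖ := by
  calc ‖T x‖ = ‖∑ j, b.repr x j • T (b j)‖ := by
        conv_lhs => rw [← b.sum_repr x, map_sum]
        simp
    _ ≤ ∑ j : ι, ‖x‖ * δ := by
        refine norm_sum_le_of_le _ fun j _ => ?_
        rw [norm_smul]
        gcongr
        · exact (PiLp.norm_apply_le _ j).trans_eq (b.repr.norm_map x)
        · exact hδ j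
    _ = Fintype.card ι * δ * ‖x‖ := by simp; ring

/-- **Corollary 3.3.** If `π : A → B(H)` is an irreducible representation of a unital
`C*`-algebra `A`, then `π(U(A))` is dense in `U(H)` in the strong operator topology:
for every unitary `u` on `H`, `ε > 0` and vectors `v₁, …, vₙ`, there is `g ∈ U(A)` with
`‖π(g)vᵢ − u vᵢ‖ < ε` for all `i`. -/
theorem unitaryGroup_image_strongly_dense
    {A : Type*} [NormedRing A] [StarRing A] [CStarRing A] [CompleteSpace A]
    [NormedAlgebra ℂ A] [StarModule ℂ A]
    {H : Type*} [NormedAddCommGroup H] [InnerProductSpace ℂ H] [CompleteSpace H]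
    (π : A →⋆ₐ[ℂ] (H →L[ℂ] H))
    (hirr : ∀ K : Submodule ℂ H, IsClosed (K : Set H) →
      (∀ a : A, ∀ v ∈ K, π a v ∈ K) → K = ⊥ ∨ K = ⊤) :
    ∀ u : H →L[ℂ] H, u ∈ unitary (H →L[ℂ] H) →
      ∀ ε : ℝ, 0 < ε → ∀ (n : ℕ) (v : Fin n → H),
        ∃ g ∈ unitary A, ∀ i, ‖π g (v i) - u (v i)‖ < ε := by
  let : CStarAlgebra A := { }
  have hπ : Continuous π := AddMonoidHomClass.continuous_of_bound π 1 fun a => by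
    simpa using NonUnitalStarAlgHom.norm_apply_le π a
  intro u hu ε hε n v
  obtain ⟨E, _, W, hW, hWv⟩ := exists_finiteDimensional_unitary_eq_apply hu v
  obtain ⟨h, hh, rfl⟩ := exists_isSelfAdjoint_exp_eq hW
  let b := stdOrthonormalBasis ℂ E
  let T : H →L[ℂ] H := E.subtypeL ∘L h ∘L E.subtypeL.adjoint
  have hT : IsSelfAdjoint T := hh.conj_adjoint E.subtypeL
  have hTE : ∀ x : E, T x = h x := fun x => by
    simp [T, Submodule.adjoint_subtypeL]
  let C : ℝ := ∑ i, ‖v i‖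
  obtain ⟨δ, hδ, hδε⟩ : ∃ δ : ℝ, 0 < δ ∧ Fintype.card (Fin (Module.finrank ℂ E)) * δ * C < ε := by
    refine ((((continuous_const.mul continuous_id).mul continuous_const).tendsto' 0 0
      (by simp)).eventually_lt_const hε).filter_mono nhdsWithin_le_nhds |>.and
      self_mem_nhdsWithin |>.exists (f := nhdsWithin (0 : ℝ) (Set.Ioi 0)) |>.imp fun _ h => h.symm
  obtain ⟨a, ha, hab⟩ := exists_isSelfAdjoint_forall_norm_sub_lt π hirr hT (fun j => (b j : H)) hδ
  refine ⟨NormedSpace.exp (Complex.I • a), by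
    simpa using ha.exp_smul_I_smul_mem_unitary 1, fun i => ?_⟩
  obtain ⟨hvi, hWvi⟩ := hWv i
  have hexp : π (NormedSpace.exp (Complex.I • a)) = NormedSpace.exp (Complex.I • π a) := by
    let +nondep : NormedAlgebra ℚ A := .restrictScalars ℚ ℂ A
    let +nondep : NormedAlgebra ℚ (H →L[ℂ] H) := .restrictScalars ℚ ℂ _
    rw [NormedSpace.map_exp π hπ, map_smul]
  have key := norm_apply_exp_sub_exp_apply_le E.subtypeL hh (ha.map π)
    (norm_apply_le_of_orthonormalBasis b (E.subtypeL ∘L h - π a ∘L E.subtypeL) fun j => by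
      have := (hab j).le
      rwa [hTE] at this) ⟨v i, hvi⟩
  rw [norm_sub_rev, ← hWvi, hexp]
  refine key.trans_lt (hδε.trans_le' ?_)
  gcongr
  exact Finset.single_le_sum (f := fun i => ‖v i‖) (fun _ _ => norm_nonneg _) (Finset.mem_univ i)
end
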